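/- Let 1 < p < 2. Then for every real number s, the function t ↦ (1 − cos(st))/t^{p+1} is integrable on (0,∞) and ∫_0^{+∞} (1 − cos(st))/t^{p+1} dt = |s|^p · Γ(1−p) · cos(pπ/2)/p. -/

import Mathlib

open MeasureTheory Real

lemma aux_tonelli (f : ℝ → ℝ → ℝ) (hm : Measurable (Function.uncurry f))
    (hf : ∀ x, 0 < x → ∀ y, 0 < y → 0 ≤ f x y) (g h : ℝ → ℝ)
    (hg : ∀ x, 0 < x → ∫ y in Set.Ioi (0:ℝ), f x y = g x)
    (hi : ∀ y, 0 < y → IntegrableOn (fun x => f x y) (Set.Ioi 0))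
    (hh : ∀ y, 0 < y → ∫ x in Set.Ioi (0:ℝ), f x y = h y)
    (hhi : IntegrableOn h (Set.Ioi 0)) :
    IntegrableOn g (Set.Ioi 0) ∧
      ∫ x in Set.Ioi (0:ℝ), g x = ∫ y in Set.Ioi (0:ℝ), h y := by
  have hI : Integrable (Function.uncurry f)
      ((volume.restrict (Set.Ioi (0:ℝ))).prod (volume.restrict (Set.Ioi (0:ℝ)))) := by
    rw [integrable_prod_iff' hm.aestronglyMeasurable]
    constructor
    · filter_upwards [ae_restrict_mem measurableSet_Ioi] with y hy using hi y hy
    · refine IntegrableOn.congr_fun hhi (fun y hy => ?_) measurableSet_Ioi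
      rw [← hh y hy]
      refine setIntegral_congr_fun measurableSet_Ioi (fun x hx => ?_)
      exact (Real.norm_of_nonneg (hf x hx y hy)).symm
  constructor
  · refine IntegrableOn.congr_fun (f := fun x => ∫ y in Set.Ioi (0:ℝ), f x y)
      hI.integral_prod_left (fun x hx => hg x hx) measurableSet_Ioi
  · rw [← setIntegral_congr_fun measurableSet_Ioi (fun x hx => hg x hx),
      ← setIntegral_congr_fun measurableSet_Ioi (fun x hx => hh x hx)]
    exact integral_integral_swap hI

lemma aux_exp (q b : ℝ) (hq : -1 < q) (hb : 0 < b) :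
    IntegrableOn (fun x : ℝ => x ^ q * exp (-b * x)) (Set.Ioi 0) ∧
    ∫ x in Set.Ioi (0:ℝ), x ^ q * exp (-b * x) = b ^ (-(q + 1)) * Gamma (q + 1) := by
  have h1 := integrableOn_rpow_mul_exp_neg_mul_rpow hq one_pos hb
  have h2 := integral_rpow_mul_exp_neg_mul_rpow one_pos hq hb
  simp only [rpow_one, div_one, mul_one] at h1 h2
  exact ⟨h1, h2⟩

/-- Laplace transform of `1 - cos`. -/
lemma aux_lap (x : ℝ) (hx : 0 < x) :
    IntegrableOn (fun t : ℝ => (1 - cos t) * exp (-x * t)) (Set.Ioi 0) ∧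
    ∫ t in Set.Ioi (0:ℝ), (1 - cos t) * exp (-x * t) = 1 / (x * (1 + x ^ 2)) := by
  have hd : ∀ t ∈ Set.Ici (0:ℝ), HasDerivAt
      (fun t => exp (-x * t) * (-1 / x + (x * cos t - sin t) / (1 + x ^ 2)))
      ((1 - cos t) * exp (-x * t)) t := by
    intro t _
    have h1 : HasDerivAt (fun t => exp (-x * t)) (exp (-x * t) * (-x * 1)) t :=
      ((hasDerivAt_id t).const_mul (-x)).exp
    have h2 := ((((hasDerivAt_cos t).const_mul x).sub (hasDerivAt_sin t)).div_const
      (1 + x ^ 2)).const_add (-1 / x)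
    convert! h1.mul h2 using 1
    simp only [Pi.sub_apply]
    field_simp
    ring
  have hp : ∀ t ∈ Set.Ioi (0:ℝ), 0 ≤ (1 - cos t) * exp (-x * t) := fun t _ =>
    mul_nonneg (sub_nonneg.2 (cos_le_one t)) (exp_pos _).le
  have hl : Filter.Tendsto
      (fun t => exp (-x * t) * (-1 / x + (x * cos t - sin t) / (1 + x ^ 2)))
      Filter.atTop (nhds 0) := by
    have he : Filter.Tendsto (fun t => exp (-x * t)) Filter.atTop (nhds 0) := by
      refine tendsto_exp_atBot.comp ?_
      exact Filter.tendsto_id.const_mul_atTop_of_neg (neg_lt_zero.2 hx)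
    refine he.zero_mul_isBoundedUnder_le ?_
    refine Filter.isBoundedUnder_of ⟨1 / x + (x + 1) / (1 + x ^ 2), fun t => ?_⟩
    simp only [Function.comp_apply, Real.norm_eq_abs]
    refine (abs_add_le _ _).trans (add_le_add ?_ ?_)
    · rw [abs_div, abs_of_pos hx]; simp
    · rw [abs_div, abs_of_pos (show 0 < 1 + x ^ 2 by positivity)]
      gcongr
      refine (abs_sub _ _).trans (add_le_add ?_ (abs_sin_le_one t))
      rw [abs_mul, abs_of_pos hx]
      exact mul_le_of_le_one_right hx.le (abs_cos_le_one t)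
  refine ⟨integrableOn_Ioi_deriv_of_nonneg' hd hp hl, ?_⟩
  rw [integral_Ioi_of_hasDerivAt_of_nonneg' hd hp hl]
  simp
  field_simp
  ring

lemma aux_J (p : ℝ) (hp1 : 1 < p) (hp2 : p < 2) :
    IntegrableOn (fun x : ℝ => x ^ (p - 1) / (1 + x ^ 2)) (Set.Ioi 0) ∧
    ∫ x in Set.Ioi (0:ℝ), x ^ (p - 1) / (1 + x ^ 2) = π / (2 * sin (π * (p / 2))) := by
  obtain ⟨e1, e2⟩ := aux_exp (-p / 2) 1 (by linarith) one_pos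
  have := aux_tonelli (fun x y => x ^ (p - 1) * exp (-(1 + x ^ 2) * y))
    (by unfold Function.uncurry; fun_prop)
    (fun x hx y hy => by positivity)
    (fun x => x ^ (p - 1) / (1 + x ^ 2))
    (fun y => (1 / 2 * Gamma (p / 2)) * (y ^ (-p / 2) * exp (-1 * y)))
    (fun x hx => by
      have := (aux_exp 0 (1 + x ^ 2) (by norm_num) (by positivity)).2
      simp only [rpow_zero, one_mul, zero_add, Gamma_one, mul_one] at this
      rw [integral_const_mul, this, rpow_neg_one, div_eq_mul_inv])
    (fun y hy => by
      refine IntegrableOn.congr_fun ((integrableOn_rpow_mul_exp_neg_mul_sq hy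
        (show -1 < p - 1 by linarith)).const_mul (exp (-y))) (fun x hx => ?_) measurableSet_Ioi
      rw [mul_left_comm, ← exp_add]; ring_nf)
    (fun y hy => by
      have := integral_rpow_mul_exp_neg_mul_rpow two_pos (show -1 < p - 1 by linarith) hy
      simp only [rpow_two, sub_add_cancel] at this
      rw [show 1 / 2 * Gamma (p / 2) * (y ^ (-p / 2) * exp (-1 * y)) =
        exp (-y) * (y ^ (-p / 2) * (1 / 2) * Gamma (p / 2)) by ring_nf, ← this,
        ← integral_const_mul]
      congr 1
      ext x
      rw [mul_left_comm, ← exp_add]; ring_nf)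
    (e1.const_mul _)
  refine ⟨this.1, this.2.trans ?_⟩
  rw [integral_const_mul, e2, one_rpow, one_mul,
    show -p / 2 + 1 = 1 - p / 2 by ring, mul_assoc, Gamma_mul_Gamma_one_sub]
  ring

lemma aux_one (p : ℝ) (hp1 : 1 < p) (hp2 : p < 2) :
    IntegrableOn (fun t : ℝ => (1 - cos t) / t ^ (p + 1)) (Set.Ioi 0) volume ∧
    ∫ t in Set.Ioi (0 : ℝ), (1 - cos t) / t ^ (p + 1)
      = Gamma (1 - p) * cos (p * π / 2) / p := by
  obtain ⟨e1, e2⟩ := aux_J p hp1 hp2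
  have hG : Gamma (p + 1) = p * Gamma p := Gamma_add_one (by linarith)
  have hGp : 0 < Gamma p := Gamma_pos_of_pos (by linarith)
  have := aux_tonelli (fun t x => (1 - cos t) * (x ^ p * exp (-t * x)))
    (by unfold Function.uncurry; fun_prop)
    (fun t ht x hx => mul_nonneg (sub_nonneg.2 (cos_le_one t)) (by positivity))
    (fun t => (Gamma (p + 1)) * ((1 - cos t) / t ^ (p + 1)))
    (fun x => x ^ (p - 1) / (1 + x ^ 2))
    (fun t ht => by
      rw [integral_const_mul, (aux_exp p t (by linarith) ht).2, rpow_neg ht.le]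
      ring)
    (fun x hx => by
      refine IntegrableOn.congr_fun ((aux_lap x hx).1.const_mul (x ^ p)) (fun t ht => ?_)
        measurableSet_Ioi
      ring_nf)
    (fun x hx => by
      have : x ^ (p - 1) / (1 + x ^ 2) = x ^ p * (1 / (x * (1 + x ^ 2))) := by
        rw [rpow_sub_one hx.ne']
        field_simp
      rw [this, ← (aux_lap x hx).2, ← integral_const_mul]
      congr 1
      ext t
      ring_nf)
    e1
  obtain ⟨h1, h2⟩ := this
  have hne : Gamma (p + 1) ≠ 0 := by rw [hG]; exact (mul_pos (by linarith) hGp).ne'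
  constructor
  · refine IntegrableOn.congr_fun (h1.const_mul (Gamma (p + 1))⁻¹) (fun t ht => ?_)
      measurableSet_Ioi
    rw [inv_mul_cancel_left₀ hne]
  · rw [integral_const_mul, e2, hG] at h2
    have hr := Gamma_mul_Gamma_one_sub p
    have hs : sin (π * p) = 2 * sin (π * (p / 2)) * cos (π * (p / 2)) := by
      rw [← sin_two_mul]; ring_nf
    have hsin : 0 < sin (π * (p / 2)) :=
      sin_pos_of_pos_of_lt_pi (by have := pi_pos; positivity) (by nlinarith [pi_pos])
    have hcos : cos (π * (p / 2)) < 0 :=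
      cos_neg_of_pi_div_two_lt_of_lt (by nlinarith [pi_pos]) (by nlinarith [pi_pos])
    have hp0 : p ≠ 0 := by linarith
    rw [show p * π / 2 = π * (p / 2) by ring]
    rw [hs] at hr
    have hkey : Gamma p * (Gamma (1 - p) * cos (π * (p / 2))) =
        π / (2 * sin (π * (p / 2))) := by
      rw [← mul_assoc, hr]
      have hc := hcos.ne
      have hs0 := hsin.ne'
      generalize cos (π * (p / 2)) = c at *
      generalize sin (π * (p / 2)) = d at *
      field_simp
    rw [← hkey] at h2
    rw [eq_div_iff hp0]
    apply mul_left_cancel₀ hGp.ne'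
    rw [← h2]; ring

theorem stmt4 (p : ℝ) (hp1 : 1 < p) (hp2 : p < 2) (s : ℝ) :
    IntegrableOn (fun t : ℝ => (1 - Real.cos (s * t)) / t ^ (p + 1)) (Set.Ioi 0) volume ∧
    ∫ t in Set.Ioi (0 : ℝ), (1 - Real.cos (s * t)) / t ^ (p + 1)
      = |s| ^ p * (Real.Gamma (1 - p) * Real.cos (p * π / 2) / p) := by
  rcases eq_or_ne s 0 with rfl | hs
  · simp [zero_rpow (show p ≠ 0 by linarith)]
  · have ha : 0 < |s| := abs_pos.2 hs
    obtain ⟨h1, h2⟩ := aux_one p hp1 hp2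
    have hc : ∀ t ∈ Set.Ioi (0:ℝ), |s| ^ (p + 1) * ((1 - cos (|s| * t)) / (|s| * t) ^ (p + 1))
        = (1 - cos (s * t)) / t ^ (p + 1) := by
      intro t ht
      have ht' : 0 < t := ht
      have : cos (|s| * t) = cos (s * t) := by
        rw [← cos_abs (s * t), abs_mul, abs_of_pos ht']
      rw [this, mul_rpow ha.le ht'.le]
      have := rpow_pos_of_pos ha (p + 1)
      have := rpow_pos_of_pos ht' (p + 1)
      field_simp
    constructor
    · refine IntegrableOn.congr_fun (Integrable.const_mul ?_ _) hc measurableSet_Ioi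
      have := (integrableOn_Ioi_comp_mul_left_iff
        (fun t : ℝ => (1 - cos t) / t ^ (p + 1)) 0 ha).2 (by simpa using h1)
      exact this
    · rw [← setIntegral_congr_fun measurableSet_Ioi hc, integral_const_mul,
        integral_comp_mul_left_Ioi (fun t : ℝ => (1 - cos t) / t ^ (p + 1)) 0 ha, mul_zero, h2,
        rpow_add_one ha.ne', smul_eq_mul]
      field_simp
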